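/- For every real α ≥ 2 there exist constants c(α) > 0 and C(α) > 0 such that every finite simple graph on n ≥ 2 vertices that admits a vector α-coloring contains an independent set of size at least c(α)·n^(f(α))/(log n)^(C(α)). -/

import Mathlib

/-- The function `f : [1,∞) → ℝ` with `f(1) = 1` and, for `α > 1`,
`f(α) = α(α−1) / ( k·( α(α−k) + (k−1)(k+1)/3 ) )` where `k = ⌊α⌋`. -/
noncomputable def f (α : ℝ) : ℝ :=
  if α = 1 then 1
  else α * (α - 1) /
    ((⌊α⌋ : ℝ) * (α * (α - (⌊α⌋ : ℝ)) + ((⌊α⌋ : ℝ) - 1) * ((⌊α⌋ : ℝ) + 1) / 3))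

open MeasureTheory ProbabilityTheory

section Gaussian

lemma exists_gaussianReal_tail_lower_bound : ∃ c : ℝ, 0 < c ∧ c ≤ 1 ∧ ∀ t : ℝ, 0 ≤ t →
    c * Real.exp (-t ^ 2 / 2) / (t + 1) ≤ (gaussianReal 0 1).real (Set.Ici t) := by
  have hpi : (1 : ℝ) ≤ √(2 * Real.pi) := by
    rw [Real.one_le_sqrt]
    nlinarith [Real.pi_gt_three]
  refine ⟨(√(2 * Real.pi))⁻¹ * Real.exp (-(3 / 2)), by positivity, ?_, fun t ht => ?_⟩
  · have h1 : (√(2 * Real.pi))⁻¹ ≤ 1 := inv_le_one_of_one_le₀ hpi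
    have h2 : Real.exp (-(3 / 2)) ≤ 1 := Real.exp_le_one_iff.2 (by norm_num)
    exact mul_le_one₀ h1 (Real.exp_pos _).le h2
  · have hle : ∀ x ∈ Set.Icc t (t + 1 / (t + 1)),
        (√(2 * Real.pi))⁻¹ * Real.exp (-(3 / 2)) * Real.exp (-t ^ 2 / 2) ≤
          gaussianPDFReal 0 1 x := by
      intro x hx
      simp only [gaussianPDFReal, NNReal.coe_one, mul_one, sub_zero]
      rw [mul_assoc, ← Real.exp_add]
      gcongr
      have hu : 1 / (t + 1) * (t + 1) = 1 := by field_simp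
      have hu0 : 0 < 1 / (t + 1) := by positivity
      have hu1 : 1 / (t + 1) ≤ 1 := by
        rw [div_le_one (by positivity)]; linarith
      have hsq : x ^ 2 ≤ (t + 1 / (t + 1)) ^ 2 := pow_le_pow_left₀ (ht.trans hx.1) hx.2 2
      nlinarith
    have hvol : (volume (Set.Icc t (t + 1 / (t + 1)))) ≠ ⊤ := by simp
    have hint : Integrable (gaussianPDFReal 0 1) := integrable_gaussianPDFReal 0 1
    have h1 := setIntegral_ge_of_const_le_real measurableSet_Icc hvol hle hint.integrableOn
    have h2 : ∫ x in Set.Icc t (t + 1 / (t + 1)), gaussianPDFReal 0 1 x ≤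
        ∫ x in Set.Ici t, gaussianPDFReal 0 1 x :=
      setIntegral_mono_set hint.integrableOn
        (Filter.Eventually.of_forall fun x => gaussianPDFReal_nonneg 0 1 x)
        (Filter.Eventually.of_forall fun x hx => hx.1)
    have h3 : (gaussianReal 0 1).real (Set.Ici t) = ∫ x in Set.Ici t, gaussianPDFReal 0 1 x := by
      rw [Measure.real, gaussianReal_apply_eq_integral 0 one_ne_zero, ENNReal.toReal_ofReal]
      exact integral_nonneg fun x => gaussianPDFReal_nonneg 0 1 x
    rw [h3]
    refine le_trans (le_of_eq ?_) (h1.trans h2)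
    rw [Real.volume_real_Icc_of_le (by simp; positivity)]
    ring

variable {E : Type*} [NormedAddCommGroup E] [InnerProductSpace ℝ E] [FiniteDimensional ℝ E]
  [MeasurableSpace E] [BorelSpace E]

lemma map_inner_stdGaussian (w : E) :
    (stdGaussian E).map (fun r => inner ℝ w r) = gaussianReal 0 (‖w‖₊ ^ 2) := by
  have h := IsGaussian.map_eq_gaussianReal (μ := stdGaussian E) (innerSL ℝ w)
  rw [integral_strongDual_stdGaussian, variance_dual_stdGaussian, innerSL_apply_norm] at h
  have hw : (‖w‖ ^ 2).toNNReal = ‖w‖₊ ^ 2 := by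
    rw [← NNReal.coe_inj]
    simp
  rw [← hw]
  exact h

lemma stdGaussian_real_inner_ge_eq {w : E} (hw : ‖w‖ = 1) (t : ℝ) :
    (stdGaussian E).real {r | t ≤ inner ℝ w r} = (gaussianReal 0 1).real (Set.Ici t) := by
  have h := map_inner_stdGaussian w
  have hw' : ‖w‖₊ = 1 := by rw [← NNReal.coe_inj]; simpa using hw
  rw [hw', one_pow] at h
  rw [← h, map_measureReal_apply (by fun_prop) measurableSet_Ici]
  rfl

lemma stdGaussian_real_inner_ge_le {w : E} {τ s : ℝ} (hτ : 0 < τ) (hw : ‖w‖ ^ 2 ≤ τ)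
    (hs : 0 ≤ s) :
    (stdGaussian E).real {r | s ≤ inner ℝ w r} ≤ Real.exp (-s ^ 2 / (2 * τ)) := by
  have hmap := map_inner_stdGaussian w
  have hX : AEMeasurable (fun r : E => inner ℝ w r) (stdGaussian E) := by fun_prop
  have hint : Integrable (fun r : E => Real.exp (s / τ * inner ℝ w r)) (stdGaussian E) := by
    have h : Integrable (fun x : ℝ => Real.exp (s / τ * x)) (gaussianReal 0 (‖w‖₊ ^ 2)) :=
      integrable_exp_mul_gaussianReal _
    rw [← hmap] at h
    exact h.comp_aemeasurable hX
  refine (measure_ge_le_exp_mul_mgf s (by positivity) hint).trans ?_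
  rw [mgf_gaussianReal hmap, ← Real.exp_add, Real.exp_le_exp]
  simp only [NNReal.coe_pow, coe_nnnorm]
  have h : ‖w‖ ^ 2 * (s / τ) ^ 2 ≤ τ * (s / τ) ^ 2 := by gcongr
  have h2 : τ * (s / τ) ^ 2 = s ^ 2 / τ := by field_simp
  have h3 : -(s / τ) * s = -(s ^ 2 / τ) := by ring
  have h4 : -s ^ 2 / (2 * τ) = -(s ^ 2 / τ) / 2 := by field_simp
  rw [h3, h4]
  linarith

end Gaussian

/-- If every vertex `i` of `A` carries a random event `X i` of probability at least `p`, at most `D`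
neighbours in `A`, and the events of adjacent vertices occur jointly with probability at most `q`,
then `A` contains an independent set of size at least `|A| (p - D q)`. -/
lemma exists_indep_of_events {V Ω : Type*} [MeasurableSpace Ω] (μ : Measure Ω)
    [IsProbabilityMeasure μ] (G : SimpleGraph V) (A : Finset V) (X : V → Set Ω)
    (hX : ∀ i, MeasurableSet (X i)) {p q D : ℝ} (hq0 : 0 ≤ q)
    (hp : ∀ i ∈ A, p ≤ μ.real (X i))
    (hq : ∀ i ∈ A, ∀ j ∈ A, G.Adj i j → μ.real (X i ∩ X j) ≤ q)
    (hD : ∀ i ∈ A, ∀ N ⊆ A, (∀ j ∈ N, G.Adj i j) → (N.card : ℝ) ≤ D) :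
    ∃ S ⊆ A, (∀ i ∈ S, ∀ j ∈ S, ¬ G.Adj i j) ∧ A.card * (p - D * q) ≤ S.card := by
  classical
  let F : Ω → ℝ := fun ω => ∑ i ∈ A, ((X i).indicator 1 ω -
    ∑ j ∈ A with G.Adj i j, (X i ∩ X j).indicator 1 ω)
  have hind : ∀ s : Set Ω, MeasurableSet s → Integrable (s.indicator (1 : Ω → ℝ)) μ :=
    fun s hs => (integrable_const (1 : ℝ)).indicator hs
  have hsum : ∀ i, Integrable
      (fun ω => ∑ j ∈ A with G.Adj i j, (X i ∩ X j).indicator (1 : Ω → ℝ) ω) μ :=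
    fun i => integrable_finsetSum _ fun j _ => hind _ ((hX i).inter (hX j))
  have hF : Integrable F μ :=
    integrable_finsetSum _ fun i _ => (hind _ (hX i)).sub (hsum i)
  have hEF : A.card * (p - D * q) ≤ ∫ ω, F ω ∂μ := by
    have : ∫ ω, F ω ∂μ = ∑ i ∈ A, (μ.real (X i) -
        ∑ j ∈ A with G.Adj i j, μ.real (X i ∩ X j)) := by
      refine (integral_finsetSum _ fun i _ => (hind _ (hX i)).sub (hsum i)).trans ?_
      refine Finset.sum_congr rfl fun i _ => ?_
      rw [integral_sub' (hind _ (hX i)) (hsum i), integral_indicator_one (hX i),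
        integral_finsetSum _ fun j _ => hind _ ((hX i).inter (hX j))]
      congr 1
      exact Finset.sum_congr rfl fun j _ => integral_indicator_one ((hX i).inter (hX j))
    rw [this, ← nsmul_eq_mul]
    refine Finset.card_nsmul_le_sum _ _ _ fun i hi => ?_
    have h1 : ∑ j ∈ A with G.Adj i j, μ.real (X i ∩ X j) ≤
        (A.filter (G.Adj i)).card • q := by
      refine Finset.sum_le_card_nsmul _ _ _ fun j hj => ?_
      rw [Finset.mem_filter] at hj
      exact hq i hi j hj.1 hj.2
    have h2 : ((A.filter (G.Adj i)).card : ℝ) ≤ D :=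
      hD i hi _ (Finset.filter_subset _ _) fun j hj => (Finset.mem_filter.1 hj).2
    rw [nsmul_eq_mul] at h1
    have h3 := mul_le_mul_of_nonneg_right h2 hq0
    linarith [hp i hi]
  obtain ⟨ω, hω⟩ := exists_integral_le hF
  refine ⟨A.filter fun i => ω ∈ X i ∧ ∀ j ∈ A, G.Adj i j → ω ∉ X j, Finset.filter_subset _ _,
    ?_, (hEF.trans hω).trans ?_⟩
  · intro i hi j hj hij
    rw [Finset.mem_filter] at hi hj
    exact hi.2.2 j hj.1 hij hj.2.1
  · rw [Finset.card_filter, Nat.cast_sum]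
    refine Finset.sum_le_sum fun i _ => ?_
    have hnn : ∀ j ∈ A.filter (G.Adj i), 0 ≤ (X i ∩ X j).indicator (1 : Ω → ℝ) ω :=
      fun j _ => Set.indicator_nonneg (fun _ _ => zero_le_one) _
    by_cases hi : ω ∈ X i
    · by_cases hj : ∀ j ∈ A, G.Adj i j → ω ∉ X j
      · rw [if_pos ⟨hi, hj⟩]
        simpa [hi] using Finset.sum_nonneg hnn
      · rw [if_neg fun h => hj h.2]
        push Not at hj
        obtain ⟨j, hjA, hij, hj⟩ := hj
        have := Finset.single_le_sum hnn (Finset.mem_filter.2 ⟨hjA, hij⟩)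
        simp only [Set.indicator_of_mem (Set.mem_inter hi hj), Pi.one_apply] at this
        simpa [hi] using this
    · simp [hi]

/-- `v` restricts to a vector `α`-coloring of the subgraph of `G` induced on `A`. -/
def IsVectorColoringOn {V E : Type*} [NormedAddCommGroup E] [InnerProductSpace ℝ E]
    (α : ℝ) (G : SimpleGraph V) (v : V → E) (A : Finset V) : Prop :=
  (∀ i ∈ A, ‖v i‖ = 1) ∧
    ∀ i ∈ A, ∀ j ∈ A, G.Adj i j → inner ℝ (v i) (v j) ≤ -(1 / (α - 1))

namespace IsVectorColoringOn

variable {V E : Type*} [NormedAddCommGroup E] [InnerProductSpace ℝ E]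
  {α : ℝ} {G : SimpleGraph V} {v : V → E} {A : Finset V}

lemma norm_add_sq_le (h : IsVectorColoringOn α G v A) (hα : 2 ≤ α) {i j : V} (hi : i ∈ A)
    (hj : j ∈ A) (hij : G.Adj i j) : ‖v i + v j‖ ^ 2 ≤ 2 * (α - 2) / (α - 1) := by
  have h1 : 0 < α - 1 := by linarith
  have h2 : 2 * (α - 2) / (α - 1) = 2 - 2 * (1 / (α - 1)) := by field_simp; ring
  rw [norm_add_sq_real, h.1 i hi, h.1 j hj, h2]
  linarith [h.2 i hi j hj hij]

/-- A vector `α`-colored graph with `α < 3` is triangle free. -/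
lemma not_adj_of_lt_three (h : IsVectorColoringOn α G v A) (hα : 2 ≤ α) (hα3 : α < 3) {i j k : V}
    (hi : i ∈ A) (hj : j ∈ A) (hk : k ∈ A) (hij : G.Adj i j) (hik : G.Adj i k) :
    ¬ G.Adj j k := by
  intro hjk
  have h1 : 1 / 2 < 1 / (α - 1) := one_div_lt_one_div_of_lt (by linarith) (by linarith)
  have h2 : ‖v i + v j + v k‖ ^ 2 = 3 + 2 * inner ℝ (v i) (v j) + 2 * inner ℝ (v i) (v k) +
      2 * inner ℝ (v j) (v k) := by
    rw [norm_add_sq_real, norm_add_sq_real, inner_add_left, h.1 i hi, h.1 j hj, h.1 k hk]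
    ring
  nlinarith [h.2 i hi j hj hij, h.2 i hi k hk hik, h.2 j hj k hk hjk, sq_nonneg ‖v i + v j + v k‖]

/-- The neighbourhood of a vertex of a vector `α`-colored graph is vector `(α - 1)`-colorable:
project the vectors to the orthogonal complement of that of the vertex and normalize. -/
lemma exists_neighbors (h : IsVectorColoringOn α G v A) (hα : 2 < α) {i : V} (hi : i ∈ A)
    {N : Finset V} (hN : N ⊆ A) (hadj : ∀ j ∈ N, G.Adj i j) :
    ∃ w : V → E, IsVectorColoringOn (α - 1) G w N := by
  classical
  let a : V → ℝ := fun j => inner ℝ (v i) (v j)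
  let u : V → E := fun j => v j - a j • v i
  have hii : inner ℝ (v i) (v i) = (1 : ℝ) := by
    rw [real_inner_self_eq_norm_sq, h.1 i hi, one_pow]
  have huu : ∀ j k, inner ℝ (u j) (u k) = inner ℝ (v j) (v k) - a j * a k := by
    intro j k
    simp only [u, a, inner_sub_left, inner_sub_right, real_inner_smul_left, real_inner_smul_right,
      hii, real_inner_comm (v i) (v j)]
    ring
  have hnorm : ∀ j ∈ N, ‖u j‖ ^ 2 = 1 - a j ^ 2 := by
    intro j hj
    rw [← real_inner_self_eq_norm_sq, huu, real_inner_self_eq_norm_sq, h.1 j (hN hj)]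
    ring
  set s : ℝ := 1 / (α - 1) with hs
  have hs0 : 0 < s := by rw [hs]; apply one_div_pos.2; linarith
  have hs1 : s < 1 := by rw [hs, div_lt_one] <;> linarith
  have hsα : 1 / (α - 1 - 1) = s / (1 - s) := by
    have h1 : α - 1 ≠ 0 := by linarith
    have h2 : α - 1 - 1 ≠ 0 := by linarith
    have h3 : 1 - s = (α - 1 - 1) / (α - 1) := by rw [hs]; field_simp
    rw [h3, hs]
    field_simp
  have ha : ∀ j ∈ N, a j ≤ -s := fun j hj => h.2 i hi j (hN hj) (hadj j hj)
  refine ⟨fun j => if u j = 0 then v i else ‖u j‖⁻¹ • u j, ?_, ?_⟩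
  · intro j _
    dsimp only
    split_ifs with hj
    · exact h.1 i hi
    · rw [norm_smul, norm_inv, norm_norm, inv_mul_cancel₀ (norm_ne_zero_iff.2 hj)]
  · intro j hj k hk hjk
    have haj := ha j hj
    have hak := ha k hk
    have hlt : inner ℝ (u j) (u k) ≤ -(s + s ^ 2) := by
      rw [huu]
      have := h.2 j (hN hj) k (hN hk) hjk
      nlinarith
    have hj0 : u j ≠ 0 := fun h0 => by
      rw [h0, inner_zero_left] at hlt
      nlinarith
    have hk0 : u k ≠ 0 := fun h0 => by
      rw [h0, inner_zero_right] at hlt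
      nlinarith
    have hpj : 0 < ‖u j‖ := norm_pos_iff.2 hj0
    have hpk : 0 < ‖u k‖ := norm_pos_iff.2 hk0
    dsimp only
    rw [if_neg hj0, if_neg hk0, real_inner_smul_left, real_inner_smul_right, hsα]
    have hprod : ‖u j‖ * ‖u k‖ ≤ 1 - s ^ 2 := by
      nlinarith [hnorm j hj, hnorm k hk, sq_nonneg (‖u j‖ - ‖u k‖)]
    have h1s : 0 < 1 - s := by linarith
    have hre : ‖u j‖⁻¹ * (‖u k‖⁻¹ * inner ℝ (u j) (u k)) =
        inner ℝ (u j) (u k) / (‖u j‖ * ‖u k‖) := by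
      field_simp
    rw [hre, div_le_iff₀ (by positivity)]
    have hr : s / (1 - s) * (‖u j‖ * ‖u k‖) ≤ s / (1 - s) * (1 - s ^ 2) := by gcongr
    have hr' : s / (1 - s) * (1 - s ^ 2) = s + s ^ 2 := by field_simp; ring
    linarith

end IsVectorColoringOn

/-- **Karger–Motwani–Sudan**: a vector `α`-colored graph on `n` vertices of maximum degree at most
`D` has an independent set of size at least `n / D ^ (1 - 2 / α)`, up to polylogarithmic factors. -/
lemma exists_indep_of_degree_le {α : ℝ} (hα : 2 ≤ α) : ∃ c : ℝ, 0 < c ∧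
    ∀ (n m : ℕ) (G : SimpleGraph (Fin n)) (v : Fin n → EuclideanSpace ℝ (Fin m))
      (A : Finset (Fin n)) (D : ℝ), A.Nonempty → IsVectorColoringOn α G v A → 1 ≤ D →
      (∀ i ∈ A, ∀ N ⊆ A, (∀ j ∈ N, G.Adj i j) → (N.card : ℝ) ≤ D) →
      ∃ S ⊆ A, (∀ i ∈ S, ∀ j ∈ S, ¬ G.Adj i j) ∧
        c * A.card / (D ^ (1 - 2 / α) * (1 + Real.log A.card) ^ (2 : ℝ)) ≤ S.card := by
  obtain ⟨c₀, hc₀, hc₀1, htail⟩ := exists_gaussianReal_tail_lower_bound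
  have hmeas : ∀ {m : ℕ} (t : ℝ) (w : EuclideanSpace ℝ (Fin m)),
      MeasurableSet {r : EuclideanSpace ℝ (Fin m) | t ≤ inner ℝ w r} :=
    fun t w => measurableSet_le measurable_const (by fun_prop)
  rcases hα.eq_or_lt with rfl | hα2
  · refine ⟨c₀ * Real.exp (-1 ^ 2 / 2) / (1 + 1), by positivity, fun n m G v A D hA hv hD hdeg => ?_⟩
    obtain ⟨S, hSA, hS, hcard⟩ := exists_indep_of_events (stdGaussian (EuclideanSpace ℝ (Fin m)))
      G A (fun i => {r | 1 ≤ inner ℝ (v i) r}) (fun i => hmeas 1 (v i)) le_rfl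
      (fun i hi => (htail 1 zero_le_one).trans_eq (stdGaussian_real_inner_ge_eq (hv.1 i hi) 1).symm)
      (fun i hi j hj hij => by
        have h0 : v i + v j = 0 := by
          have := hv.norm_add_sq_le le_rfl hi hj hij
          norm_num at this
          exact this
        have : {r | 1 ≤ inner ℝ (v i) r} ∩ {r | 1 ≤ inner ℝ (v j) r} = ∅ := by
          ext r
          have hr : inner ℝ (v i) r + inner ℝ (v j) r = 0 := by
            rw [← inner_add_left, h0, inner_zero_left]
          simp only [Set.mem_inter_iff, Set.mem_ofPred_eq, Set.mem_empty_iff_false, iff_false]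
          rintro ⟨h1, h2⟩
          linarith
        simp [this]) hdeg
    refine ⟨S, hSA, hS, le_trans ?_ hcard⟩
    have hL : 0 ≤ Real.log A.card := Real.log_natCast_nonneg _
    have hL2 : (1 : ℝ) ≤ (1 + Real.log A.card) ^ (2 : ℝ) :=
      Real.one_le_rpow (by linarith) (by norm_num)
    rw [mul_zero, sub_zero, mul_comm (A.card : ℝ), div_self two_ne_zero, sub_self, Real.rpow_zero,
      one_mul]
    exact div_le_self (by positivity) hL2
  · set K : ℝ := (8 / c₀) ^ 2 with hK
    have h8 : 1 ≤ 8 / c₀ := by rw [one_le_div hc₀]; linarith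
    have hK1 : 1 ≤ K := one_le_pow₀ h8
    have hlogK : 2 * (2 + Real.log K) ≤ c₀ * K := by
      have h1 : Real.log K ≤ 2 * (8 / c₀ - 1) := by
        rw [hK, Real.log_pow]
        push_cast
        gcongr
        exact Real.log_le_sub_one_of_pos (by positivity)
      have h2 : c₀ * K = 8 * (8 / c₀) := by rw [hK]; field_simp
      rw [h2]
      linarith
    refine ⟨(K ^ 2)⁻¹, by positivity, fun n m G v A D₀ hA hv hD₀ hdeg₀ => ?_⟩
    have hcard1 : (1 : ℝ) ≤ A.card := by exact_mod_cast hA.card_pos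
    set D : ℝ := min D₀ A.card with hDdef
    have hD : 1 ≤ D := le_min hD₀ hcard1
    have hdeg : ∀ i ∈ A, ∀ N ⊆ A, (∀ j ∈ N, G.Adj i j) → (N.card : ℝ) ≤ D :=
      fun i hi N hN hadj => le_min (hdeg₀ i hi N hN hadj) (by
        exact_mod_cast Finset.card_le_card hN)
    set L : ℝ := 1 + Real.log A.card with hL
    have hlogA : 0 ≤ Real.log A.card := Real.log_natCast_nonneg _
    have hL1 : 1 ≤ L := by linarith
    set β : ℝ := 1 - 2 / α with hβ
    have hβα : β = (α - 2) / α := by rw [hβ]; field_simp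
    have hβ0 : 0 < β := by rw [hβα]; exact div_pos (by linarith) (by linarith)
    have hβ1 : β ≤ 1 := by
      have : 0 < 2 / α := by positivity
      linarith
    set M : ℝ := D * (K * L) with hM
    have hKL : 1 ≤ K * L := one_le_mul_of_one_le_of_one_le hK1 hL1
    have hM1 : 1 ≤ M := one_le_mul_of_one_le_of_one_le hD hKL
    have hM0 : 0 < M := by linarith
    have hlogM : 0 ≤ Real.log M := Real.log_nonneg hM1
    set t : ℝ := √(2 * β * Real.log M) with ht
    have ht0 : 0 ≤ t := Real.sqrt_nonneg _
    have htsq : t ^ 2 = 2 * β * Real.log M := Real.sq_sqrt (by positivity)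
    have hexp : Real.exp (-t ^ 2 / 2) = M ^ (-β) := by
      rw [Real.rpow_def_of_pos hM0, htsq]
      congr 1
      ring
    have hlogM_le : Real.log M ≤ 2 * L - 2 + Real.log K := by
      rw [hM, Real.log_mul (by positivity) (by positivity),
        Real.log_mul (by positivity) (by positivity)]
      have h1 : Real.log D ≤ Real.log A.card := Real.log_le_log (by positivity) (min_le_right _ _)
      have h2 : Real.log L ≤ L - 1 := Real.log_le_sub_one_of_pos (by positivity)
      linarith
    have hlogK0 : 0 ≤ Real.log K := Real.log_nonneg hK1
    have ht1 : t + 1 ≤ L * (2 + Real.log K) := by nlinarith [sq_nonneg (t - 1)]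
    have htKL : 2 * (t + 1) ≤ c₀ * (K * L) := by nlinarith
    have hα1 : 0 < α - 1 := by linarith
    have hτ : 0 < 2 * (α - 2) / (α - 1) := div_pos (by linarith) hα1
    obtain ⟨S, hSA, hS, hcard⟩ := exists_indep_of_events (stdGaussian (EuclideanSpace ℝ (Fin m)))
      G A (fun i => {r | t ≤ inner ℝ (v i) r}) (fun i => hmeas t (v i))
      (q := Real.exp (-(2 * t) ^ 2 / (2 * (2 * (α - 2) / (α - 1))))) (Real.exp_pos _).le
      (fun i hi => (htail t ht0).trans_eq (stdGaussian_real_inner_ge_eq (hv.1 i hi) t).symm)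
      (fun i hi j hj hij => by
        refine le_trans (measureReal_mono ?_) (stdGaussian_real_inner_ge_le hτ
          (hv.norm_add_sq_le hα hi hj hij) (by positivity : 0 ≤ 2 * t))
        rintro r ⟨h1, h2⟩
        simp only [Set.mem_ofPred_eq] at h1 h2 ⊢
        rw [inner_add_left]
        linarith) hdeg
    refine ⟨S, hSA, hS, le_trans ?_ hcard⟩
    have hq : Real.exp (-(2 * t) ^ 2 / (2 * (2 * (α - 2) / (α - 1)))) = M ^ (-β) * M⁻¹ := by
      have hα2' : α - 2 ≠ 0 := by linarith
      rw [← Real.rpow_neg_one M, ← Real.rpow_add hM0, Real.rpow_def_of_pos hM0, mul_pow, htsq, hβα]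
      congr 1
      field_simp
      ring
    have hDM : D * M⁻¹ = (K * L)⁻¹ := by rw [hM]; field_simp
    have hMβ : D ^ (-β) * (K * L)⁻¹ ≤ M ^ (-β) := by
      rw [hM, Real.mul_rpow (by positivity) (by positivity), ← Real.rpow_neg_one (K * L)]
      gcongr
    have hp : 2 * (K * L)⁻¹ ≤ c₀ / (t + 1) := by
      rw [← div_eq_mul_inv, div_le_div_iff₀ (by positivity) (by positivity)]
      exact htKL
    have hDD : D₀ ^ (-β) ≤ D ^ (-β) :=
      Real.rpow_le_rpow_of_nonpos (by positivity) (min_le_left _ _) (by linarith)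
    have hMpos : 0 < M ^ (-β) := by positivity
    calc (K ^ 2)⁻¹ * A.card / (D₀ ^ β * L ^ (2 : ℝ))
        = A.card * (D₀ ^ (-β) * (K * L)⁻¹ * (K * L)⁻¹) := by
          rw [Real.rpow_neg (by positivity), Real.rpow_two]
          field_simp
      _ ≤ A.card * (M ^ (-β) * (K * L)⁻¹) := by
          gcongr
          refine le_trans ?_ hMβ
          gcongr
      _ ≤ _ := by
          gcongr
          rw [hq, hexp]
          have h1 : c₀ * M ^ (-β) / (t + 1) = M ^ (-β) * (c₀ / (t + 1)) := by ring
          have h2 : D * (M ^ (-β) * M⁻¹) = M ^ (-β) * (K * L)⁻¹ := by rw [← hDM]; ring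
          rw [h1, h2]
          nlinarith

/-- Every vector `α`-colored graph on `n ≥ 1` vertices has an independent set of size at least
`n ^ s`, up to polylogarithmic factors. -/
def HasIndepExponent (α s : ℝ) : Prop :=
  ∃ c : ℝ, 0 < c ∧ ∃ C : ℝ, 0 < C ∧
    ∀ (n m : ℕ) (G : SimpleGraph (Fin n)) (v : Fin n → EuclideanSpace ℝ (Fin m))
      (A : Finset (Fin n)), A.Nonempty → IsVectorColoringOn α G v A →
      ∃ S ⊆ A, (∀ i ∈ S, ∀ j ∈ S, ¬ G.Adj i j) ∧
        c * (A.card : ℝ) ^ s / (1 + Real.log A.card) ^ C ≤ S.card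

/-- Every neighbourhood of size `d ≥ 1` in a vector `α`-colored graph has an independent set of size
at least `d ^ s`, up to polylogarithmic factors. -/
def HasNeighborIndepExponent (α s : ℝ) : Prop :=
  ∃ c : ℝ, 0 < c ∧ ∃ C : ℝ, 0 < C ∧
    ∀ (n m : ℕ) (G : SimpleGraph (Fin n)) (v : Fin n → EuclideanSpace ℝ (Fin m))
      (A : Finset (Fin n)), IsVectorColoringOn α G v A →
      ∀ i ∈ A, ∀ N ⊆ A, N.Nonempty → (∀ j ∈ N, G.Adj i j) →
      ∃ S ⊆ N, (∀ i ∈ S, ∀ j ∈ S, ¬ G.Adj i j) ∧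
        c * (N.card : ℝ) ^ s / (1 + Real.log N.card) ^ C ≤ S.card

lemma hasNeighborIndepExponent_one {α : ℝ} (hα : 2 ≤ α) (hα3 : α < 3) :
    HasNeighborIndepExponent α 1 := by
  refine ⟨1, one_pos, 1, one_pos, fun n m G v A hv i hi N hNA hN hadj => ⟨N, subset_rfl, ?_, ?_⟩⟩
  · exact fun j hj k hk => hv.not_adj_of_lt_three hα hα3 hi (hNA hj) (hNA hk) (hadj j hj) (hadj k hk)
  · rw [Real.rpow_one, Real.rpow_one, one_mul]
    exact div_le_self (by positivity) (by linarith [Real.log_natCast_nonneg N.card])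

lemma HasIndepExponent.hasNeighborIndepExponent {α s : ℝ} (hα : 2 < α)
    (h : HasIndepExponent (α - 1) s) : HasNeighborIndepExponent α s := by
  obtain ⟨c, hc, C, hC, h⟩ := h
  refine ⟨c, hc, C, hC, fun n m G v A hv i hi N hNA hN hadj => ?_⟩
  obtain ⟨w, hw⟩ := hv.exists_neighbors hα hi hNA hadj
  exact h n m G w N hN hw

lemma HasNeighborIndepExponent.hasIndepExponent {α s' s : ℝ} (hα : 2 ≤ α) (hs' : 0 < s')
    (hs : 1 / s = 1 + (1 - 2 / α) / s') (h : HasNeighborIndepExponent α s') :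
    HasIndepExponent α s := by
  have hβ : 0 ≤ 1 - 2 / α := by
    rw [sub_nonneg, div_le_one (by linarith)]
    exact hα
  have hs0 : 0 < s := by
    rw [← one_div_pos, hs]
    positivity
  have hexp : 1 - s / s' * (1 - 2 / α) = s := by
    have : s * (1 / s) = s * (1 + (1 - 2 / α) / s') := by rw [hs]
    rw [mul_one_div_cancel hs0.ne'] at this
    rw [div_mul_eq_mul_div, ← mul_div_assoc']
    linarith
  obtain ⟨c₁, hc₁, h₁⟩ := exists_indep_of_degree_le hα
  obtain ⟨c₂, hc₂, C, hC, h₂⟩ := h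
  refine ⟨min c₁ c₂, lt_min hc₁ hc₂, max 2 C, by positivity, fun n m G v A hA hv => ?_⟩
  have hA1 : (1 : ℝ) ≤ A.card := by exact_mod_cast hA.card_pos
  have hlogA : 0 ≤ Real.log A.card := Real.log_natCast_nonneg _
  set D : ℝ := (A.card : ℝ) ^ (s / s') with hD
  have hD1 : 1 ≤ D := Real.one_le_rpow hA1 (by positivity)
  by_cases hdeg : ∀ i ∈ A, ∀ N ⊆ A, (∀ j ∈ N, G.Adj i j) → (N.card : ℝ) ≤ D
  · obtain ⟨S, hSA, hS, hcard⟩ := h₁ n m G v A D hA hv hD1 hdeg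
    refine ⟨S, hSA, hS, le_trans ?_ hcard⟩
    have hAs : (A.card : ℝ) / D ^ (1 - 2 / α) = (A.card : ℝ) ^ s := by
      rw [hD, ← Real.rpow_mul (by positivity), ← hexp, Real.rpow_sub (by positivity), Real.rpow_one,
        hexp]
    rw [← div_div, mul_div_assoc c₁, hAs]
    gcongr
    · exact min_le_left _ _
    · linarith
    · exact le_max_left _ _
  · push Not at hdeg
    obtain ⟨i, hi, N, hNA, hadj, hN⟩ := hdeg
    have hN1 : 1 < (N.card : ℝ) := hD1.trans_lt hN
    have hNne : N.Nonempty := Finset.card_pos.1 (by exact_mod_cast zero_lt_one.trans hN1)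
    obtain ⟨S, hSN, hS, hcard⟩ := h₂ n m G v A hv i hi N hNA hNne hadj
    refine ⟨S, hSN.trans hNA, hS, le_trans ?_ hcard⟩
    have hlogN : 0 ≤ Real.log N.card := Real.log_natCast_nonneg _
    have hNAc : (N.card : ℝ) ≤ A.card := by exact_mod_cast Finset.card_le_card hNA
    have hAs : (A.card : ℝ) ^ s ≤ (N.card : ℝ) ^ s' := by
      calc (A.card : ℝ) ^ s = D ^ s' := by
            rw [hD, ← Real.rpow_mul (by positivity), div_mul_cancel₀ _ hs'.ne']
        _ ≤ _ := by gcongr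
    have hL : (1 + Real.log N.card) ^ C ≤ (1 + Real.log A.card) ^ (max 2 C) := by
      calc (1 + Real.log N.card) ^ C ≤ (1 + Real.log A.card) ^ C := by gcongr
        _ ≤ _ := Real.rpow_le_rpow_of_exponent_le (by linarith) (le_max_right _ _)
    gcongr
    exact min_le_right _ _

lemma one_div_f_of_lt_three {α : ℝ} (hα : 2 ≤ α) (hα3 : α < 3) :
    1 / f α = 1 + (1 - 2 / α) / 1 := by
  have hk : ⌊α⌋ = 2 := by
    rw [Int.floor_eq_iff]
    push_cast
    constructor <;> linarith
  have h1 : α - 1 ≠ 0 := by linarith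
  rw [f, if_neg (by linarith), hk, one_div_div]
  push_cast
  field_simp
  ring

lemma one_div_f {α : ℝ} (hα : 3 ≤ α) : 1 / f α = 1 + (1 - 2 / α) / f (α - 1) := by
  have h1 : α - 1 ≠ 0 := by linarith
  have h2 : α - 2 ≠ 0 := by linarith
  have h2' : α - 1 - 1 ≠ 0 := by linarith
  rw [f, f, if_neg (by linarith), if_neg (by intro h; linarith), Int.floor_sub_one, one_div_div]
  push_cast
  rw [div_div_eq_mul_div]
  field_simp
  ring

lemma f_pos {α : ℝ} (hα : 2 ≤ α) : 0 < f α := by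
  have hk : (⌊α⌋ : ℝ) ≤ α := Int.floor_le α
  have hk2 : (2 : ℝ) ≤ ⌊α⌋ := by exact_mod_cast Int.le_floor.2 (by exact_mod_cast hα)
  rw [f, if_neg (by linarith)]
  have h1 : 0 ≤ α * (α - ⌊α⌋) := mul_nonneg (by linarith) (by linarith)
  have h2 : 0 < ((⌊α⌋ : ℝ) - 1) * (⌊α⌋ + 1) / 3 := by
    have : (0 : ℝ) < (⌊α⌋ : ℝ) - 1 := by linarith
    positivity
  have h3 : 0 < α - 1 := by linarith
  positivity

lemma hasIndepExponent_f (k : ℕ) : ∀ {α : ℝ}, 2 ≤ α → α < k + 3 → HasIndepExponent α (f α) := by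
  induction k with
  | zero =>
    intro α hα hα3
    have hα3' : α < 3 := by simpa using hα3
    exact (hasNeighborIndepExponent_one hα hα3').hasIndepExponent hα one_pos
      (one_div_f_of_lt_three hα hα3')
  | succ k ih =>
    intro α hα hαk
    push_cast at hαk
    rcases lt_or_ge α 3 with hα3 | hα3
    · exact ih hα (by linarith [(Nat.cast_nonneg k : (0 : ℝ) ≤ k)])
    · exact ((ih (by linarith) (by linarith)).hasNeighborIndepExponent
        (by linarith)).hasIndepExponent hα (f_pos (by linarith)) (one_div_f hα3)

theorem stmt_6 (α : ℝ) (hα : 2 ≤ α) : ∃ c : ℝ, 0 < c ∧ ∃ C : ℝ, 0 < C ∧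
    ∀ (n : ℕ), 2 ≤ n → ∀ (G : SimpleGraph (Fin n)) (v : Fin n → (Fin n → ℝ)),
      (∀ i, ∑ k, (v i k) ^ 2 = 1) →
      (∀ i j, G.Adj i j → ∑ k, v i k * v j k ≤ -(1 / (α - 1))) →
      ∃ S : Finset (Fin n), (∀ i ∈ S, ∀ j ∈ S, ¬ G.Adj i j) ∧
        c * (n : ℝ) ^ (f α) / (Real.log n) ^ C ≤ S.card := by
  obtain ⟨k, hk⟩ := exists_nat_gt α
  obtain ⟨c, hc, C, hC, h⟩ := hasIndepExponent_f k hα (by linarith)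
  have hlog2 : 0 < Real.log 2 := Real.log_pos one_lt_two
  set B : ℝ := 1 / Real.log 2 + 1 with hB
  have hB0 : 0 < B := by positivity
  refine ⟨c / B ^ C, by positivity, C, hC, fun n hn G v hnorm hadj => ?_⟩
  have : NeZero n := ⟨by omega⟩
  obtain ⟨S, -, hS, hcard⟩ := h n n G (fun i => WithLp.toLp 2 (v i)) Finset.univ
    Finset.univ_nonempty
    ⟨fun i _ => by simp [EuclideanSpace.norm_eq, hnorm i], fun i _ j _ hij => by
      simpa [PiLp.inner_apply, mul_comm] using hadj i j hij⟩
  refine ⟨S, hS, le_trans ?_ hcard⟩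
  rw [Finset.card_univ, Fintype.card_fin]
  have hlog : Real.log 2 ≤ Real.log n := Real.log_le_log two_pos (by exact_mod_cast hn)
  have hlog0 : 0 < Real.log n := hlog2.trans_le hlog
  have hle : 1 + Real.log n ≤ B * Real.log n := by
    have : 1 ≤ 1 / Real.log 2 * Real.log n := by
      rw [one_div_mul_eq_div, one_le_div hlog2]
      exact hlog
    rw [hB, add_mul, one_mul]
    linarith
  calc c / B ^ C * (n : ℝ) ^ f α / Real.log n ^ C
      = c * (n : ℝ) ^ f α / (B * Real.log n) ^ C := by
        rw [Real.mul_rpow hB0.le hlog0.le]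
        field_simp
    _ ≤ _ := by gcongr
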